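/- arXiv:2407.21522 — 5 statements merged into one kernel-verified Lean document; each statement's English description precedes it below -/
import Mathlib

section
/- Let m, N₀, H₀, r₀ be real numbers with m > 0, 0 < N₀ < 1, H₀ > 0, r₀ > 0. Assume (i) 4mH₀/N₀ + H₀²r₀² = 4, (ii) 2N₀/(H₀r₀) ≤ 1, and (iii) m(H₀N₀ + 4m/r₀²) ≥ 1 − N₀². Then N₀² = 1 − 2m/r₀; moreover equality holds in (ii) and in (iii). -/
/-- Real-arithmetic core of the positive mass case of the Israel-style
uniqueness proof for equipotential photon surfaces. -/
theorem israel_positive_mass_core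
    (m N₀ H₀ r₀ : ℝ)
    (hm : 0 < m) (hN₀ : 0 < N₀) (hN₀' : N₀ < 1) (hH₀ : 0 < H₀) (hr₀ : 0 < r₀)
    (h1 : 4 * m * H₀ / N₀ + H₀ ^ 2 * r₀ ^ 2 = 4)
    (h2 : 2 * N₀ / (H₀ * r₀) ≤ 1)
    (h3 : m * (H₀ * N₀ + 4 * m / r₀ ^ 2) ≥ 1 - N₀ ^ 2) :
    N₀ ^ 2 = 1 - 2 * m / r₀ ∧
      2 * N₀ / (H₀ * r₀) = 1 ∧
      m * (H₀ * N₀ + 4 * m / r₀ ^ 2) = 1 - N₀ ^ 2 := by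
  obtain ⟨x, rfl⟩ : ∃ x, H₀ = 2 * x / r₀ := ⟨H₀ * r₀ / 2, by field_simp⟩
  obtain ⟨μ, rfl⟩ : ∃ μ, m = μ * r₀ := ⟨m / r₀, by field_simp⟩
  have hx : 0 < x := by
    have := (div_pos_iff_of_pos_right hr₀).mp hH₀
    linarith
  have constraint : 2 * μ * x = N₀ * (1 - x ^ 2) := by
    field_simp at h1
    linarith
  have hNx : N₀ ≤ x := by
    rw [div_mul_cancel₀ _ hr₀.ne', div_le_one (by positivity)] at h2
    linarith
  have hmass : μ * r₀ * (2 * x / r₀ * N₀ + 4 * (μ * r₀) / r₀ ^ 2) =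
      2 * μ * x * N₀ + 4 * μ ^ 2 := by
    field_simp
  rw [hmass] at h3 ⊢
  have hxN : x ≤ N₀ := by
    have key : x ^ 2 * (2 * μ * x * N₀ + 4 * μ ^ 2) = N₀ ^ 2 * (1 - x ^ 2) := by
      linear_combination (x ^ 2 * N₀ + 2 * μ * x + N₀ * (1 - x ^ 2)) * constraint
    have := mul_le_mul_of_nonneg_left h3 (sq_nonneg x)
    exact (sq_le_sq₀ hx.le hN₀.le).mp (by linarith)
  obtain rfl : N₀ = x := le_antisymm hNx hxN
  have hμ : 2 * μ = 1 - N₀ ^ 2 := mul_right_cancel₀ hN₀.ne' (by linarith)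
  refine ⟨?_, ?_, ?_⟩
  · field_simp
    linarith
  · field_simp
  · linear_combination (2 * μ + 1) * hμ
end

section
/- Let m, N₀, H₀, r₀ be real numbers with m > 0, 0 < N₀ < 1, H₀ > 0, r₀ > 0. Assume 4mH₀/N₀ + H₀²r₀² = 4, together with the two inequalities 1 − N₀² ≤ 2m/r₀ and 1 − N₀² ≥ 4mN₀/(r₀²H₀). Then both inequalities are equalities: 1 − N₀² = 2m/r₀ and 1 − N₀² = 4mN₀/(r₀²H₀). -/
/-- Real-arithmetic core of the positive mass case of the Robinson-style
uniqueness proof for equipotential photon surfaces. -/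
theorem robinson_positive_mass_core
    (m N₀ H₀ r₀ : ℝ)
    (hm : 0 < m) (hN₀ : 0 < N₀) (hN₀' : N₀ < 1) (hH₀ : 0 < H₀) (hr₀ : 0 < r₀)
    (h1 : 4 * m * H₀ / N₀ + H₀ ^ 2 * r₀ ^ 2 = 4)
    (h2 : 1 - N₀ ^ 2 ≤ 2 * m / r₀)
    (h3 : 1 - N₀ ^ 2 ≥ 4 * m * N₀ / (r₀ ^ 2 * H₀)) :
    1 - N₀ ^ 2 = 2 * m / r₀ ∧ 1 - N₀ ^ 2 = 4 * m * N₀ / (r₀ ^ 2 * H₀) := by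
  have h1' : 4 * m * H₀ + H₀ ^ 2 * r₀ ^ 2 * N₀ = 4 * N₀ := by
    field_simp at h1
    linarith
  have h2' : (1 - N₀ ^ 2) * r₀ ≤ 2 * m := (le_div_iff₀ hr₀).mp h2
  have h3' : 4 * m * N₀ ≤ (1 - N₀ ^ 2) * (r₀ ^ 2 * H₀) :=
    (div_le_iff₀ (by positivity)).mp h3
  have hle : H₀ * r₀ ≤ 2 * N₀ := by
    have hprod : (H₀ * r₀ - 2 * N₀) * (2 + N₀ * (H₀ * r₀)) ≤ 0 := by
      linear_combination 2 * H₀ * h2' + h1'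
    have hpos : 0 < 2 + N₀ * (H₀ * r₀) := by positivity
    linarith [nonpos_of_mul_nonpos_left hprod hpos]
  have hge : 2 * N₀ ≤ H₀ * r₀ := by
    have hsq : (2 * N₀) ^ 2 ≤ (H₀ * r₀) ^ 2 := by
      linear_combination H₀ * h3' - N₀ * h1'
    exact (sq_le_sq₀ (by positivity) (by positivity)).mp hsq
  have hH : H₀ = 2 * N₀ / r₀ := by
    rw [eq_div_iff hr₀.ne']
    exact le_antisymm hle hge
  have heq : 1 - N₀ ^ 2 = 2 * m / r₀ := by
    rw [hH] at h1
    field_simp at h1 ⊢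
    linarith
  refine ⟨heq, ?_⟩
  rw [heq, hH]
  field_simp
  norm_num
end

section
/- Let m, N₀, H₀, r₀ be real numbers with m < 0, N₀ > 1, H₀ > 0, r₀ > 0. Assume 4mH₀/N₀ + H₀²r₀² = 4, together with the two inequalities 1 − N₀² ≤ 2m/r₀ and 1 − N₀² ≥ 4mN₀/(r₀²H₀). Then both inequalities are equalities: 1 − N₀² = 2m/r₀ and 1 − N₀² = 4mN₀/(r₀²H₀); in particular N₀² = 1 − 2m/r₀ and 2N₀/(H₀r₀) = 1. -/
/-- Real-arithmetic core of the negative mass case of the Robinson-style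
uniqueness proof for equipotential photon surfaces. -/
theorem robinson_negative_mass_core
    (m N₀ H₀ r₀ : ℝ)
    (hm : m < 0) (hN₀ : 1 < N₀) (hH₀ : 0 < H₀) (hr₀ : 0 < r₀)
    (h1 : 4 * m * H₀ / N₀ + H₀ ^ 2 * r₀ ^ 2 = 4)
    (h2 : 1 - N₀ ^ 2 ≤ 2 * m / r₀)
    (h3 : 1 - N₀ ^ 2 ≥ 4 * m * N₀ / (r₀ ^ 2 * H₀)) :
    (1 - N₀ ^ 2 = 2 * m / r₀ ∧ 1 - N₀ ^ 2 = 4 * m * N₀ / (r₀ ^ 2 * H₀)) ∧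
      N₀ ^ 2 = 1 - 2 * m / r₀ ∧ 2 * N₀ / (H₀ * r₀) = 1 := by
  have hN : 0 < N₀ := by linarith
  have hm_eq : 4 * m * H₀ = N₀ * (4 - (H₀ * r₀) ^ 2) := by
    field_simp at h1
    linarith
  have h2' : (1 - N₀ ^ 2) * r₀ ≤ 2 * m := (le_div_iff₀ hr₀).1 h2
  have h3' : 4 * m * N₀ ≤ (1 - N₀ ^ 2) * (r₀ ^ 2 * H₀) := (div_le_iff₀ (by positivity)).1 h3
  have hle : H₀ * r₀ ≤ 2 * N₀ := by
    have h : (1 - N₀ ^ 2) * r₀ * (H₀ * r₀) ≤ 2 * m * (H₀ * r₀) :=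
      mul_le_mul_of_nonneg_right h2' (by positivity)
    nlinarith
  have hge : 2 * N₀ ≤ H₀ * r₀ := by
    have h := mul_le_mul_of_nonneg_right h3' hH₀.le
    refine (sq_le_sq₀ (by positivity) (by positivity)).1 ?_
    linear_combination h - N₀ * hm_eq
  have heq : H₀ * r₀ = 2 * N₀ := le_antisymm hle hge
  have hmr : (1 - N₀ ^ 2) * r₀ = 2 * m := by
    rw [heq] at hm_eq
    refine mul_right_cancel₀ hH₀.ne' ?_
    linear_combination (1 - N₀ ^ 2) * heq - hm_eq / 2
  have hfst : 1 - N₀ ^ 2 = 2 * m / r₀ := (eq_div_iff hr₀.ne').2 hmr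
  refine ⟨⟨hfst, ?_⟩, by linarith, ?_⟩
  · rw [eq_div_iff (by positivity)]
    linear_combination (H₀ * r₀) * hmr + 2 * m * heq
  · rw [heq, div_self (by positivity)]
end

section
/- Let c, m, N₀, H₀, r₀ be real numbers with c > −1/2, c ≠ 0, N₀ > 0, H₀ > 0, r₀ > 0, and suppose m and c have the same sign (m > 0 iff c > 0 and m < 0 iff c < 0). Assume: (i) c·(N₀·√(2c+1) − 1) ≤ 0; (ii) m²/r₀² = c²N₀²/(2c+1); (iii) c²N₀² ≥ ((2c+1)/4)·(1 − N₀²)²; and (iv) (c + 1/2)·H₀²r₀² = 2. Then N₀ = 1/√(2c+1), m/r₀ = c/(2c+1), and H₀r₀ = 2/√(2c+1). -/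
/-- If `(s² - 1)(s N - 1) ≤ 0` and `s² (1 - N²)² ≤ (s² - 1)² N²` for positive `s ≠ 1` and `N`, then
`s` and `N` are inverse to each other. -/
theorem mul_eq_one_of_sq_le {s N : ℝ} (hs : 0 < s) (hN : 0 < N) (hs1 : s ^ 2 - 1 ≠ 0)
    (h : (s ^ 2 - 1) * (N * s - 1) ≤ 0)
    (hsq : (s * (1 - N ^ 2)) ^ 2 ≤ ((s ^ 2 - 1) * N) ^ 2) : N * s = 1 := by
  have habs := sq_le_sq.mp hsq
  have hsum : 0 < N + s := add_pos hN hs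
  rcases lt_or_gt_of_ne hs1 with hneg | hpos
  · have hle : 0 ≤ N * s - 1 := nonneg_of_mul_nonpos_right h hneg
    rw [abs_of_neg (mul_neg_of_neg_of_pos hneg hN)] at habs
    have hfac : (N * s - 1) * (N + s) ≤ 0 := by
      linarith [neg_abs_le (s * (1 - N ^ 2))]
    linarith [nonpos_of_mul_nonpos_left hfac hsum]
  · have hle : N * s - 1 ≤ 0 := nonpos_of_mul_nonpos_right h hpos
    rw [abs_of_pos (mul_pos hpos hN)] at habs
    have hfac : 0 ≤ (N * s - 1) * (N + s) := by
      linarith [le_abs_self (s * (1 - N ^ 2))]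
    linarith [nonneg_of_mul_nonneg_left hfac hsum]

/-- Real-arithmetic core of the Agostiniani–Mazzieri-style uniqueness
proof for equipotential photon surfaces. -/
theorem agostiniani_mazzieri_core
    (c m N₀ H₀ r₀ : ℝ)
    (hc : -1/2 < c) (hc0 : c ≠ 0)
    (hN₀ : 0 < N₀) (hH₀ : 0 < H₀) (hr₀ : 0 < r₀)
    (hsign : (0 < m ↔ 0 < c) ∧ (m < 0 ↔ c < 0))
    (h1 : c * (N₀ * Real.sqrt (2 * c + 1) - 1) ≤ 0)
    (h2 : m ^ 2 / r₀ ^ 2 = c ^ 2 * N₀ ^ 2 / (2 * c + 1))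
    (h3 : c ^ 2 * N₀ ^ 2 ≥ (2 * c + 1) / 4 * (1 - N₀ ^ 2) ^ 2)
    (h4 : (c + 1/2) * H₀ ^ 2 * r₀ ^ 2 = 2) :
    N₀ = 1 / Real.sqrt (2 * c + 1) ∧
      m / r₀ = c / (2 * c + 1) ∧
      H₀ * r₀ = 2 / Real.sqrt (2 * c + 1) := by
  have hpos : 0 < 2 * c + 1 := by linarith
  have hs : 0 < √(2 * c + 1) := Real.sqrt_pos.mpr hpos
  have hss : √(2 * c + 1) ^ 2 = 2 * c + 1 := Real.sq_sqrt hpos.le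
  set s := √(2 * c + 1)
  have hNs : N₀ * s = 1 := by
    apply mul_eq_one_of_sq_le hs hN₀
    · rw [hss]
      simpa using hc0
    · rw [hss]
      linarith
    · rw [mul_pow, mul_pow, hss]
      linarith
  refine ⟨eq_one_div_of_mul_eq_one_left hNs, ?_, ?_⟩
  · have hN2 : N₀ ^ 2 = 1 / (2 * c + 1) := by
      rw [eq_div_iff hpos.ne', ← hss, ← mul_pow, hNs, one_pow]
    have hsq : (m / r₀) ^ 2 = (c / (2 * c + 1)) ^ 2 := by
      rw [div_pow, h2, hN2]
      field_simp
    rcases lt_or_gt_of_ne hc0 with hneg | hcpos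
    · have hm := div_neg_of_neg_of_pos (hsign.2.mpr hneg) hr₀
      have hq := div_neg_of_neg_of_pos hneg hpos
      rcases sq_eq_sq_iff_eq_or_eq_neg.mp hsq with h | h <;> linarith
    · have hm := div_pos (hsign.1.mpr hcpos) hr₀
      have hq := div_pos hcpos hpos
      exact (sq_eq_sq₀ hm.le hq.le).mp hsq
  · rw [eq_div_iff hs.ne', ← sq_eq_sq₀ (by positivity) zero_le_two, mul_pow, hss]
    linarith
end

section
/- Let E be a real normed vector space, let U ⊆ E be an open connected set, and let N, W : U → ℝ be differentiable functions such that W(x) > 0 and N(x)² ≠ 1 for all x ∈ U. Suppose that for every x ∈ U the Fréchet derivative of W at x equals (−8·N(x)·W(x)/(1 − N(x)²)) times the Fréchet derivative of N at x. Then there exists a constant α > 0 such that W(x) = α·(1 − N(x)²)⁴ for all x ∈ U. -/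
theorem hasDerivAt_inv_one_sub_sq_pow_four {t : ℝ} (ht : 1 - t ^ 2 ≠ 0) :
    HasDerivAt (fun s : ℝ => ((1 - s ^ 2) ^ 4)⁻¹) (8 * t / (1 - t ^ 2) ^ 5) t := by
  have h := ((((hasDerivAt_id t).pow 2).const_sub 1).pow 4).inv (pow_ne_zero 4 ht)
  refine h.congr_deriv ?_
  simp
  field_simp
  ring

/-- Local rigidity step in the equality case of the Robinson-style
uniqueness proof: `∇W = −8NW/(1−N²)·∇N` forces `W = α(1−N²)⁴`. -/
theorem robinson_rigidity_functional_dependence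
    {E : Type*} [NormedAddCommGroup E] [NormedSpace ℝ E]
    (U : Set E) (hU : IsOpen U) (hUconn : IsConnected U)
    (N W : E → ℝ)
    (hNdiff : ∀ x ∈ U, DifferentiableAt ℝ N x)
    (hWdiff : ∀ x ∈ U, DifferentiableAt ℝ W x)
    (hWpos : ∀ x ∈ U, 0 < W x)
    (hN1 : ∀ x ∈ U, N x ^ 2 ≠ 1)
    (hgrad : ∀ x ∈ U,
      fderiv ℝ W x = (-8 * N x * W x / (1 - N x ^ 2)) • fderiv ℝ N x) :
    ∃ α : ℝ, 0 < α ∧ ∀ x ∈ U, W x = α * (1 - N x ^ 2) ^ 4 := by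
  have hD : ∀ x ∈ U, 1 - N x ^ 2 ≠ 0 := fun x hx => sub_ne_zero.mpr (hN1 x hx).symm
  have hquot : ∀ x ∈ U,
      HasFDerivAt (fun y => W y * ((1 - N y ^ 2) ^ 4)⁻¹) (0 : E →L[ℝ] ℝ) x := by
    intro x hx
    have hx0 := hD x hx
    have hinv : HasFDerivAt (fun y => ((1 - N y ^ 2) ^ 4)⁻¹)
        ((8 * N x / (1 - N x ^ 2) ^ 5) • fderiv ℝ N x) x :=
      (hasDerivAt_inv_one_sub_sq_pow_four hx0).comp_hasFDerivAt x (hNdiff x hx).hasFDerivAt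
    refine ((hWdiff x hx).hasFDerivAt.fun_mul hinv).congr_fderiv ?_
    rw [hgrad x hx, smul_smul, smul_smul, ← add_smul]
    convert zero_smul ℝ (fderiv ℝ N x) using 2
    field_simp
    ring
  obtain ⟨α, hα⟩ := hU.exists_is_const_of_fderiv_eq_zero (𝕜 := ℝ) hUconn.isPreconnected
    (fun x hx => (hquot x hx).differentiableAt.differentiableWithinAt)
    (fun x hx => (hquot x hx).fderiv)
  obtain ⟨p, hp⟩ := hUconn.nonempty
  refine ⟨α, ?_, fun x hx => ?_⟩
  · rw [← hα p hp]
    have hp0 := hD p hp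
    have hWp := hWpos p hp
    positivity
  · rw [← hα x hx, inv_mul_cancel_right₀ (pow_ne_zero 4 (hD x hx))]
end
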